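/- arXiv:2307.13987 — 3 statements merged into one kernel-verified Lean document; each statement's English description precedes it below -/
import Mathlib

section
/- If A ∈ ℝ^{N×N} is a matrix with strictly positive entries, then there exist diagonal matrices D1 and D2 with strictly positive diagonal entries such that W = D1 A D2 is doubly stochastic. -/
open scoped Matrix

/-- A positive square matrix `A` admits a positive vector maximizing
`y ↦ (∏ i, y i) / ∏ i, (A *ᵥ y) i` among all positive vectors. -/
theorem Matrix.exists_pos_forall_prod_div_prod_mulVec_le {n : Type*} [Fintype n]
    (A : Matrix n n ℝ) (hA : ∀ i j, 0 < A i j) :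
    ∃ y : n → ℝ, (∀ i, 0 < y i) ∧ ∀ z : n → ℝ, (∀ i, 0 < z i) →
      (∏ i, z i) / ∏ i, (A *ᵥ z) i ≤ (∏ i, y i) / ∏ i, (A *ᵥ y) i := by
  classical
  cases isEmpty_or_nonempty n
  · exact ⟨1, isEmptyElim, fun z _ => by simp⟩
  have hpos : ∀ y : n → ℝ, (∀ i, 0 ≤ y i) → 0 < ∑ i, y i → ∀ i, 0 < (A *ᵥ y) i := by
    intro y hy hsum i
    obtain ⟨j, -, hj⟩ := Finset.exists_lt_of_sum_lt (s := Finset.univ) (f := fun _ => (0 : ℝ))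
      (g := y) (by simpa using hsum)
    exact Finset.sum_pos' (fun k _ => mul_nonneg (hA i k).le (hy k))
      ⟨j, Finset.mem_univ j, mul_pos (hA i j) hj⟩
  have hcont : ContinuousOn (fun y : n → ℝ => (∏ i, y i) / ∏ i, (A *ᵥ y) i)
      (stdSimplex ℝ n) := by
    refine ContinuousOn.div (by fun_prop) (by fun_prop) fun y hy => ?_
    exact (Finset.prod_pos fun i _ => hpos y hy.1 (by rw [hy.2]; exact one_pos) i).ne'
  obtain ⟨y, hy, hmax⟩ := (isCompact_stdSimplex ℝ n).exists_isMaxOn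
    ⟨_, single_mem_stdSimplex ℝ (Classical.arbitrary n)⟩ hcont
  have hle : ∀ z : n → ℝ, (∀ i, 0 < z i) →
      (∏ i, z i) / ∏ i, (A *ᵥ z) i ≤ (∏ i, y i) / ∏ i, (A *ᵥ y) i := by
    intro z hz
    have hs : 0 < ∑ i, z i := Finset.sum_pos (fun i _ => hz i) Finset.univ_nonempty
    have hmem : (∑ i, z i)⁻¹ • z ∈ stdSimplex ℝ n := by
      refine ⟨fun i => mul_nonneg (inv_nonneg.2 hs.le) (hz i).le, ?_⟩
      simp only [Pi.smul_apply, smul_eq_mul, ← Finset.mul_sum]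
      exact inv_mul_cancel₀ hs.ne'
    have h := hmax hmem
    simp only [Set.mem_ofPred_eq, Matrix.mulVec_smul, Pi.smul_apply, smul_eq_mul,
      Finset.prod_mul_distrib] at h
    rwa [mul_div_mul_left] at h
    exact (Finset.prod_pos fun _ _ => inv_pos.2 hs).ne'
  refine ⟨y, fun i => (hy.1 i).lt_of_ne fun h0 => ?_, hle⟩
  have h1 := hle 1 fun _ => one_pos
  rw [Finset.prod_eq_zero (Finset.mem_univ i) h0.symm, zero_div] at h1
  refine h1.not_gt (div_pos (by simp) (Finset.prod_pos fun k _ => hpos 1 ?_ ?_ k))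
  · exact fun _ => zero_le_one
  · exact Finset.sum_pos (fun _ _ => one_pos) Finset.univ_nonempty

/-- A positive square matrix `A` admits a positive vector `y` such that scaling the columns of `A`
by `y` and then normalizing the rows yields a matrix whose columns sum to one. -/
theorem Matrix.exists_pos_forall_sum_inv_mulVec_mul {n : Type*} [Fintype n]
    (A : Matrix n n ℝ) (hA : ∀ i j, 0 < A i j) :
    ∃ y : n → ℝ, (∀ i, 0 < y i) ∧ (∀ i, 0 < (A *ᵥ y) i) ∧
      ∀ j, ∑ i, ((A *ᵥ y) i)⁻¹ * A i j * y j = 1 := by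
  classical
  obtain ⟨y, hy, hmax⟩ := A.exists_pos_forall_prod_div_prod_mulVec_le hA
  have hpos : ∀ z : n → ℝ, (∀ i, 0 < z i) → ∀ i, 0 < (A *ᵥ z) i := fun z hz i =>
    Finset.sum_pos (fun j _ => mul_pos (hA i j) (hz j)) ⟨i, Finset.mem_univ i⟩
  refine ⟨y, hy, hpos y hy, fun j => ?_⟩
  let w : ℝ → n → ℝ := fun t => y + t • Pi.single j 1
  let g : ℝ → ℝ := fun t =>
    ∑ i, Real.log (w t i) - ∑ i, Real.log ((A *ᵥ y) i + t * A i j)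
  have hg : ∀ t, (∀ i, 0 < w t i) →
      g t = Real.log ((∏ i, w t i) /
        ∏ i, (A *ᵥ w t) i) := by
    intro t ht
    rw [Real.log_div (Finset.prod_pos fun i _ => ht i).ne'
        (Finset.prod_pos fun i _ => hpos _ ht i).ne',
      Real.log_prod fun i _ => (ht i).ne', Real.log_prod fun i _ => (hpos _ ht i).ne']
    simp [g, w, Matrix.mulVec_add, Matrix.mulVec_smul]
  have hloc : IsLocalMax g 0 := by
    have hev : ∀ᶠ t : ℝ in nhds 0, ∀ i, 0 < w t i := by
      refine Filter.eventually_all.2 fun i => ?_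
      have hc : Continuous fun t : ℝ => w t i := by
        simp only [w, Pi.add_apply, Pi.smul_apply]
        fun_prop
      exact hc.continuousAt.eventually (lt_mem_nhds (by simpa [w] using hy i))
    filter_upwards [hev] with t ht
    rw [hg t ht, hg 0 (by simpa [w] using hy)]
    refine Real.log_le_log (div_pos (Finset.prod_pos fun i _ => ht i)
      (Finset.prod_pos fun i _ => hpos _ ht i)) ?_
    simpa [w] using hmax _ ht
  have hderiv : HasDerivAt g
      (∑ i, (Pi.single j (1 : ℝ) : n → ℝ) i / y i - ∑ i, A i j / (A *ᵥ y) i) 0 := by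
    refine HasDerivAt.sub (HasDerivAt.fun_sum fun i _ => ?_) (HasDerivAt.fun_sum fun i _ => ?_)
    · have h := ((hasDerivAt_id (0 : ℝ)).mul_const ((Pi.single j (1 : ℝ) : n → ℝ) i)).const_add
        (y i)
      simpa [w] using h.log (by simpa using (hy i).ne')
    · have h := ((hasDerivAt_id (0 : ℝ)).mul_const (A i j)).const_add ((A *ᵥ y) i)
      simpa using h.log (by simpa using (hpos y hy i).ne')
  have h0 := hloc.hasDerivAt_eq_zero hderiv
  have hs : ∑ i, (Pi.single j (1 : ℝ) : n → ℝ) i / y i = 1 / y j := by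
    rw [Finset.sum_eq_single j] <;> simp +contextual
  rw [hs, sub_eq_zero] at h0
  rw [← Finset.sum_mul]
  simp only [div_eq_inv_mul, mul_one] at h0
  rw [← h0, inv_mul_cancel₀ (hy j).ne']


/-- **Sinkhorn's theorem (existence part).**
If A has strictly positive entries, then there are diagonal matrices D₁, D₂ with
strictly positive diagonal entries such that D₁ A D₂ is doubly stochastic. -/
theorem sinkhorn_existence (N : ℕ) (A : Matrix (Fin N) (Fin N) ℝ)
    (hA : ∀ i j, 0 < A i j) :
    ∃ d₁ d₂ : Fin N → ℝ, (∀ i, 0 < d₁ i) ∧ (∀ i, 0 < d₂ i) ∧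
      (∀ i j, 0 ≤ (Matrix.diagonal d₁ * A * Matrix.diagonal d₂) i j) ∧
      (∀ i, ∑ j, (Matrix.diagonal d₁ * A * Matrix.diagonal d₂) i j = 1) ∧
      (∀ j, ∑ i, (Matrix.diagonal d₁ * A * Matrix.diagonal d₂) i j = 1) := by
  obtain ⟨y, hy, hr, hc⟩ := A.exists_pos_forall_sum_inv_mulVec_mul hA
  refine ⟨fun i => ((A *ᵥ y) i)⁻¹, y, fun i => inv_pos.2 (hr i), hy, ?_, ?_, ?_⟩ <;>
    simp only [Matrix.mul_diagonal, Matrix.diagonal_mul]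
  · exact fun i j => (mul_pos (mul_pos (inv_pos.2 (hr i)) (hA i j)) (hy j)).le
  · intro i
    simp only [mul_assoc, ← Finset.mul_sum]
    exact inv_mul_cancel₀ (hr i).ne'
  · exact hc
end

section
/- Let A ∈ ℝ^{N×N} have strictly positive entries. If D1, D2 and E1, E2 are diagonal matrices with strictly positive diagonal entries such that both D1 A D2 and E1 A E2 are doubly stochastic, then there exists a scalar c > 0 such that E1 = c·D1 and E2 = c⁻¹·D2; consequently D1 A D2 = E1 A E2, i.e., the doubly stochastic matrix of the form D1 A D2 is unique. -/
/-- A real N×N matrix is doubly stochastic if its entries are nonnegative and all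
row sums and column sums equal 1. -/
def IsDoublyStochastic {N : ℕ} (W : Matrix (Fin N) (Fin N) ℝ) : Prop :=
  (∀ i j, 0 ≤ W i j) ∧ (∀ i, ∑ j, W i j = 1) ∧ (∀ j, ∑ i, W i j = 1)

/-- If a matrix with positive entries and unit row and column sums is rescaled by positive vectors
`x` (rows) and `y` (columns) so that all row and column sums are again `1`, then `x` and `y` are
constant and inverse to each other. -/
theorem exists_const_of_rescaled_sums_eq_one {m n : Type*} [Fintype m] [Fintype n] [Nonempty m]
    {P : m → n → ℝ} (hP : ∀ i j, 0 < P i j)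
    (hrow : ∀ i, ∑ j, P i j = 1) (hcol : ∀ j, ∑ i, P i j = 1)
    {x : m → ℝ} {y : n → ℝ} (hx : ∀ i, 0 < x i)
    (hrow' : ∀ i, ∑ j, x i * P i j * y j = 1) (hcol' : ∀ j, ∑ i, x i * P i j * y j = 1) :
    ∃ c : ℝ, 0 < c ∧ (∀ i, x i = c) ∧ ∀ j, y j = c⁻¹ := by
  obtain ⟨k, hk⟩ := Finite.exists_max x
  have hcol_eq (j : n) : (∑ i, P i j * x i) * y j = 1 := by
    rw [← hcol' j, Finset.sum_mul]
    exact Finset.sum_congr rfl fun i _ => by ring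
  have hrow_eq (i : m) : x i * ∑ j, P i j * y j = 1 := by
    rw [← hrow' i, Finset.mul_sum]
    exact Finset.sum_congr rfl fun j _ => by ring
  have hcol_pos (j : n) : 0 < ∑ i, P i j * x i :=
    Finset.sum_pos (fun i _ => mul_pos (hP i j) (hx i)) Finset.univ_nonempty
  have hy_ge (j : n) : (x k)⁻¹ ≤ y j := by
    rw [eq_inv_of_mul_eq_one_right (hcol_eq j)]
    refine inv_anti₀ (hcol_pos j) ?_
    calc ∑ i, P i j * x i ≤ ∑ i, P i j * x k :=
          Finset.sum_le_sum fun i _ => mul_le_mul_of_nonneg_left (hk i) (hP i j).le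
      _ = x k := by rw [← Finset.sum_mul, hcol, one_mul]
  have hsum : ∑ j, P k j * (x k)⁻¹ = ∑ j, P k j * y j := by
    rw [← Finset.sum_mul, hrow, one_mul, eq_inv_of_mul_eq_one_right (hrow_eq k)]
  have hy (j : n) : y j = (x k)⁻¹ :=
    (mul_left_cancel₀ (hP k j).ne' ((Finset.sum_eq_sum_iff_of_le fun j _ =>
      mul_le_mul_of_nonneg_left (hy_ge j) (hP k j).le).1 hsum j (Finset.mem_univ j))).symm
  refine ⟨x k, hx k, fun i => ?_, hy⟩
  have h := hrow_eq i
  simp only [hy, ← Finset.sum_mul, hrow, one_mul] at h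
  exact eq_of_mul_inv_eq_one h

/-- **Sinkhorn's theorem (uniqueness part).**
If A has strictly positive entries and D₁ A D₂ and E₁ A E₂ are both doubly stochastic
with D₁, D₂, E₁, E₂ diagonal with strictly positive diagonals, then E₁ = c·D₁ and
E₂ = c⁻¹·D₂ for some scalar c > 0; consequently D₁ A D₂ = E₁ A E₂. -/
theorem sinkhorn_uniqueness (N : ℕ) (A : Matrix (Fin N) (Fin N) ℝ)
    (hA : ∀ i j, 0 < A i j)
    (d₁ d₂ e₁ e₂ : Fin N → ℝ)
    (hd₁ : ∀ i, 0 < d₁ i) (hd₂ : ∀ i, 0 < d₂ i)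
    (he₁ : ∀ i, 0 < e₁ i) (he₂ : ∀ i, 0 < e₂ i)
    (hD : IsDoublyStochastic (Matrix.diagonal d₁ * A * Matrix.diagonal d₂))
    (hE : IsDoublyStochastic (Matrix.diagonal e₁ * A * Matrix.diagonal e₂)) :
    ∃ c : ℝ, 0 < c ∧ (∀ i, e₁ i = c * d₁ i) ∧ (∀ i, e₂ i = c⁻¹ * d₂ i) ∧
      Matrix.diagonal d₁ * A * Matrix.diagonal d₂ =
        Matrix.diagonal e₁ * A * Matrix.diagonal e₂ := by
  rcases isEmpty_or_nonempty (Fin N) with _ | _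
  · exact ⟨1, one_pos, isEmptyElim, isEmptyElim, Subsingleton.elim _ _⟩
  obtain ⟨-, hDrow, hDcol⟩ := hD
  obtain ⟨-, hErow, hEcol⟩ := hE
  simp only [Matrix.mul_diagonal, Matrix.diagonal_mul] at hDrow hDcol hErow hEcol
  have hscale (i j : Fin N) :
      e₁ i / d₁ i * (d₁ i * A i j * d₂ j) * (e₂ j / d₂ j) = e₁ i * A i j * e₂ j := by
    have := (hd₁ i).ne'
    have := (hd₂ j).ne'
    field_simp
  obtain ⟨c, hc, hx, hy⟩ := exists_const_of_rescaled_sums_eq_one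
    (P := fun i j => d₁ i * A i j * d₂ j) (x := fun i => e₁ i / d₁ i) (y := fun j => e₂ j / d₂ j)
    (fun i j => mul_pos (mul_pos (hd₁ i) (hA i j)) (hd₂ j)) hDrow hDcol
    (fun i => div_pos (he₁ i) (hd₁ i)) (by simpa only [hscale] using hErow)
    (by simpa only [hscale] using hEcol)
  have h₁ (i : Fin N) : e₁ i = c * d₁ i := (div_eq_iff (hd₁ i).ne').1 (hx i)
  have h₂ (j : Fin N) : e₂ j = c⁻¹ * d₂ j := (div_eq_iff (hd₂ j).ne').1 (hy j)
  refine ⟨c, hc, h₁, h₂, ?_⟩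
  ext i j
  simp only [Matrix.mul_diagonal, Matrix.diagonal_mul, h₁, h₂]
  field_simp
end

section
/- Let P ∈ ℝ^{N×N} be a joint PMF matrix with strictly positive entries, i.e., P(i,j) > 0 for all i, j and Σ_{i,j} P(i,j) = 1. Then there exist an integer L with 1 ≤ L ≤ N² − 2N + 2, positive reals q_1, …, q_L with Σ_{l=1}^{L} q_l = 1, and N×N matrices G_1, …, G_L such that P = Σ_{l=1}^{L} q_l G_l, where each G_l is a generalized permutation matrix whose entries are nonnegative and sum to 1 (so each G_l is itself a joint PMF matrix whose support is the graph of a permutation of {1,…,N}). -/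
open Finset Matrix

/-- **Sinkhorn's theorem** for entrywise positive matrices. -/
theorem exists_diagonal_scaling_mem_doublyStochastic {n : Type*} [Fintype n] [DecidableEq n]
    [Nonempty n] (P : Matrix n n ℝ) (hP : ∀ i j, 0 < P i j) :
    ∃ r c : n → ℝ, (∀ i, 0 < r i) ∧ (∀ j, 0 < c j) ∧
      Matrix.of (fun i j => r i * P i j * c j) ∈ doublyStochastic ℝ n := by
  have row_pos : ∀ x : n → ℝ, (∀ j, 0 ≤ x j) → (∃ j, 0 < x j) → ∀ i, 0 < ∑ j, P i j * x j := by
    rintro x hx ⟨k, hk⟩ i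
    exact sum_pos' (fun j _ => mul_nonneg (hP i j).le (hx j)) ⟨k, mem_univ k, mul_pos (hP i k) hk⟩
  have simplex_pos : ∀ x ∈ stdSimplex ℝ n, ∃ j, 0 < x j := by
    intro x hx
    by_contra! h
    linarith [hx.2, sum_nonpos fun j (_ : j ∈ univ) => h j]
  -- `φ` is homogeneous of degree zero, so its maximum on the simplex is global.
  let φ : (n → ℝ) → ℝ := fun x => (∏ j, x j) / ∏ i, ∑ j, P i j * x j
  have homog : ∀ (s : ℝ) (x : n → ℝ), s ≠ 0 → φ (fun j => s * x j) = φ x := by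
    intro s x hs
    have : ∀ i, ∑ j, P i j * (s * x j) = s * ∑ j, P i j * x j := fun i => by
      rw [mul_sum]; exact sum_congr rfl fun j _ => by ring
    simp only [φ, this, prod_mul_distrib, prod_const]
    exact mul_div_mul_left _ _ (pow_ne_zero _ hs)
  have pos_of_pos : ∀ x : n → ℝ, (∀ j, 0 < x j) → 0 < φ x := fun x hx =>
    div_pos (prod_pos fun j _ => hx j)
      (prod_pos fun i _ => row_pos x (fun j => (hx j).le) ⟨Classical.arbitrary n, hx _⟩ i)
  obtain ⟨x, hxS, hmax⟩ : ∃ x ∈ stdSimplex ℝ n, IsMaxOn φ (stdSimplex ℝ n) x := by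
    refine (isCompact_stdSimplex ℝ n).exists_isMaxOn
      ⟨_, single_mem_stdSimplex ℝ (Classical.arbitrary n)⟩ ?_
    refine ContinuousOn.div (by fun_prop) (by fun_prop) fun x hx => ?_
    exact (prod_pos fun i _ => row_pos x hx.1 (simplex_pos x hx) i).ne'
  have le_max : ∀ y : n → ℝ, (∀ j, 0 < y j) → φ y ≤ φ x := by
    intro y hy
    have hs : 0 < ∑ j, y j := sum_pos (fun j _ => hy j) univ_nonempty
    rw [← homog (∑ j, y j)⁻¹ y (inv_ne_zero hs.ne')]
    refine hmax ⟨fun j => (mul_pos (inv_pos.2 hs) (hy j)).le, ?_⟩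
    rw [← mul_sum, inv_mul_cancel₀ hs.ne']
  have hφx : 0 < φ x := (pos_of_pos (fun _ => 1) fun _ => one_pos).trans_le
    (le_max _ fun _ => one_pos)
  have hx : ∀ j, 0 < x j := by
    intro j
    refine (hxS.1 j).lt_of_ne fun h => hφx.ne' ?_
    simp only [φ, prod_eq_zero (mem_univ j) h.symm, zero_div]
  have hr : ∀ i, 0 < ∑ j, P i j * x j := row_pos x hxS.1 (simplex_pos x hxS)
  have log_φ : ∀ y : n → ℝ, (∀ j, 0 < y j) →
      Real.log (φ y) = ∑ j, Real.log (y j) - ∑ i, Real.log (∑ j, P i j * y j) := by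
    intro y hy
    have h := row_pos y (fun j => (hy j).le) ⟨Classical.arbitrary n, hy _⟩
    rw [Real.log_div (prod_pos fun j _ => hy j).ne' (prod_pos fun i _ => h i).ne',
      Real.log_prod fun j _ => (hy j).ne', Real.log_prod fun i _ => (h i).ne']
  have critical : ∀ k, ∑ i, P i k / ∑ j, P i j * x j = 1 / x k := by
    intro k
    let y : ℝ → n → ℝ := fun t j => x j + t * (if j = k then 1 else 0)
    have hy : ∀ i t, ∑ j, P i j * y t j = (∑ j, P i j * x j) + t * P i k := by
      intro i t
      simp [y, mul_add, sum_add_distrib, mul_comm]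
    have y_zero : y 0 = x := by simp [y]
    have y_cont : ∀ j, Continuous fun t => y t j := fun j => by fun_prop
    have y_pos : ∀ᶠ t in nhds (0 : ℝ), ∀ j, 0 < y t j := by
      rw [Filter.eventually_all]
      intro j
      exact (y_cont j).continuousAt.eventually (lt_mem_nhds (by simpa [y] using hx j))
    have h_max : IsLocalMax
        (fun t => ∑ j, Real.log (y t j) - ∑ i, Real.log (∑ j, P i j * y t j)) 0 := by
      filter_upwards [y_pos] with t ht
      rw [← log_φ _ ht, y_zero, ← log_φ _ hx]
      exact Real.log_le_log (pos_of_pos _ ht) (le_max _ ht)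
    have h_deriv : HasDerivAt
        (fun t => ∑ j, Real.log (y t j) - ∑ i, Real.log (∑ j, P i j * y t j))
        (∑ j, (if j = k then 1 else 0) / x j - ∑ i, P i k / ∑ j, P i j * x j) 0 := by
      refine HasDerivAt.sub (HasDerivAt.fun_sum fun j _ => ?_) (HasDerivAt.fun_sum fun i _ => ?_)
      · have h := ((hasDerivAt_id (0 : ℝ)).mul_const (if j = k then (1 : ℝ) else 0)).const_add (x j)
        simpa [y] using h.log (by simpa using (hx j).ne')
      · simp only [hy]
        have h := ((hasDerivAt_id (0 : ℝ)).mul_const (P i k)).const_add (∑ j, P i j * x j)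
        simpa using h.log (by simpa using (hr i).ne')
    have h := h_max.hasDerivAt_eq_zero h_deriv
    simp only [ite_div, zero_div, sum_ite_eq', mem_univ, if_true] at h
    linarith
  refine ⟨fun i => (∑ j, P i j * x j)⁻¹, x, fun i => inv_pos.2 (hr i), hx, ?_⟩
  rw [mem_doublyStochastic_iff_sum]
  refine ⟨fun i j => ?_, fun i => ?_, fun j => ?_⟩
  · exact (mul_pos (mul_pos (inv_pos.2 (hr i)) (hP i j)) (hx j)).le
  · simp only [Matrix.of_apply, mul_assoc]
    rw [← mul_sum, inv_mul_cancel₀ (hr i).ne']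
  · simp only [Matrix.of_apply]
    rw [← sum_mul, eq_comm, ← div_eq_iff (hx j).ne', ← critical j]
    exact sum_congr rfl fun i _ => by rw [div_eq_mul_inv, mul_comm]

/-- The square matrices all of whose row and column sums vanish. -/
def zeroLineSum (n : Type*) [Fintype n] : Submodule ℝ (Matrix n n ℝ) where
  carrier := {M | (∀ i, ∑ j, M i j = 0) ∧ ∀ j, ∑ i, M i j = 0}
  zero_mem' := by simp
  add_mem' := by
    rintro A B ⟨hA, hA'⟩ ⟨hB, hB'⟩
    simp [sum_add_distrib, hA, hA', hB, hB']
  smul_mem' := by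
    rintro c A ⟨hA, hA'⟩
    simp [← mul_sum, hA, hA']

theorem finrank_zeroLineSum_le (n : ℕ) :
    Module.finrank ℝ (zeroLineSum (Fin (n + 1))) ≤ n ^ 2 := by
  let f : zeroLineSum (Fin (n + 1)) →ₗ[ℝ] Matrix (Fin n) (Fin n) ℝ :=
    { toFun := fun M => M.1.submatrix Fin.castSucc Fin.castSucc
      map_add' := fun _ _ => rfl
      map_smul' := fun _ _ => rfl }
  have hf : Function.Injective f := by
    rw [← LinearMap.ker_eq_bot, LinearMap.ker_eq_bot']
    rintro ⟨M, hrow, hcol⟩ hM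
    have h₁ : ∀ i j : Fin n, M i.castSucc j.castSucc = 0 := fun i j => congrFun₂ hM i j
    have h₂ : ∀ i : Fin n, M i.castSucc (Fin.last n) = 0 := fun i => by
      simpa [Fin.sum_univ_castSucc, h₁] using hrow i.castSucc
    have h₃ : ∀ j, M (Fin.last n) j = 0 := by
      intro j
      have h := hcol j
      rw [Fin.sum_univ_castSucc] at h
      refine Fin.lastCases (fun h => ?_) (fun j h => ?_) j h
      · simpa [h₂] using h
      · simpa [h₁] using h
    ext i j
    refine Fin.lastCases (h₃ j) (fun i => ?_) i
    exact Fin.lastCases (h₂ i) (fun j => h₁ i j) j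
  calc
    _ ≤ Module.finrank ℝ (Matrix (Fin n) (Fin n) ℝ) := LinearMap.finrank_le_finrank_of_injective hf
    _ = n ^ 2 := by simp [Module.finrank_matrix, sq]

theorem vectorSpan_doublyStochastic_le (n : Type*) [Fintype n] [DecidableEq n] :
    vectorSpan ℝ (doublyStochastic ℝ n : Set (Matrix n n ℝ)) ≤ zeroLineSum n := by
  refine Submodule.span_le.2 ?_
  rintro _ ⟨A, hA, B, hB, rfl⟩
  obtain ⟨-, hA, hA'⟩ := mem_doublyStochastic_iff_sum.1 hA
  obtain ⟨-, hB, hB'⟩ := mem_doublyStochastic_iff_sum.1 hB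
  exact ⟨fun i => by simp [hA, hB], fun j => by simp [hA', hB']⟩

/-- The **Birkhoff–von Neumann theorem** with the Marcus–Ree bound on the number of terms. -/
theorem exists_eq_sum_perm_card_le_of_mem_doublyStochastic {n : ℕ}
    {S : Matrix (Fin (n + 1)) (Fin (n + 1)) ℝ} (hS : S ∈ doublyStochastic ℝ (Fin (n + 1))) :
    ∃ (L : ℕ) (w : Fin L → ℝ) (σ : Fin L → Equiv.Perm (Fin (n + 1))), L ≤ n ^ 2 + 1 ∧
      (∀ l, 0 < w l) ∧ ∑ l, w l = 1 ∧ ∑ l, w l • (σ l).permMatrix ℝ = S := by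
  have h : S ∈ convexHull ℝ {σ.permMatrix ℝ | σ : Equiv.Perm (Fin (n + 1))} := by
    rwa [← doublyStochastic_eq_convexHull_permMatrix]
  obtain ⟨ι, _, z, w, hz, hind, hw, hw1, hsum⟩ := eq_pos_convex_span_of_mem_convexHull h
  choose σ hσ using fun i => hz ⟨i, rfl⟩
  let e := (Fintype.equivFin ι).symm
  refine ⟨Fintype.card ι, w ∘ e, σ ∘ e, ?_, fun l => hw _, ?_, ?_⟩
  · have hsub : Set.range z ⊆ doublyStochastic ℝ (Fin (n + 1)) := by
      rintro _ ⟨i, rfl⟩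
      rw [← hσ i]
      exact permMatrix_mem_doublyStochastic
    have := (Submodule.finrank_mono ((vectorSpan_mono ℝ hsub).trans
      (vectorSpan_doublyStochastic_le _))).trans (finrank_zeroLineSum_le n)
    have := hind.card_le_finrank_succ
    omega
  · rw [← hw1]
    exact e.sum_comp w
  · rw [← hsum, ← e.sum_comp]
    simp [hσ]


/-- **Lemma 1 of the paper.**
A joint PMF matrix P with strictly positive entries can be written as a convex
combination (with strictly positive weights) of at most N² − 2N + 2 generalized
permutation matrices, each of which is itself a joint PMF matrix whose support is
the graph of a permutation of {1,…,N}. -/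
theorem joint_pmf_generalized_permutation_decomposition (N : ℕ)
    (P : Matrix (Fin N) (Fin N) ℝ)
    (hpos : ∀ i j, 0 < P i j)
    (hsum : ∑ i, ∑ j, P i j = 1) :
    ∃ L : ℕ, 1 ≤ L ∧ (L : ℤ) ≤ (N : ℤ) ^ 2 - 2 * N + 2 ∧
      ∃ (q : Fin L → ℝ) (G : Fin L → Matrix (Fin N) (Fin N) ℝ),
        (∀ l, 0 < q l) ∧ (∑ l, q l = 1) ∧
        (∀ l i j, 0 ≤ G l i j) ∧
        (∀ l, ∑ i, ∑ j, G l i j = 1) ∧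
        (∀ l, ∃ π : Equiv.Perm (Fin N), ∀ i j, 0 < G l i j ↔ j = π i) ∧
        P = ∑ l, q l • G l := by
  obtain ⟨n, rfl⟩ : ∃ n, N = n + 1 := by
    refine Nat.exists_eq_succ_of_ne_zero ?_
    rintro rfl
    simp at hsum
  obtain ⟨r, c, hr, hc, hS⟩ := exists_diagonal_scaling_mem_doublyStochastic P hpos
  obtain ⟨L, w, σ, hL, hw, hw1, hdec⟩ := exists_eq_sum_perm_card_le_of_mem_doublyStochastic hS
  let H : Fin L → Matrix (Fin (n + 1)) (Fin (n + 1)) ℝ := fun l =>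
    Matrix.of fun i j => if j = σ l i then (r i * c j)⁻¹ else 0
  have hrc : ∀ i j, 0 < (r i * c j)⁻¹ := fun i j => inv_pos.2 (mul_pos (hr i) (hc j))
  have H_nonneg : ∀ l i j, 0 ≤ H l i j := fun l i j => by
    simp only [H, Matrix.of_apply]
    split_ifs
    exacts [(hrc i j).le, le_rfl]
  have H_pos : ∀ l i j, 0 < H l i j ↔ j = σ l i := fun l i j => by
    simp only [H, Matrix.of_apply]
    split_ifs with h
    exacts [iff_of_true (hrc i j) h, iff_of_false (lt_irrefl _) h]
  have mass_pos : ∀ l, 0 < ∑ i, ∑ j, H l i j := fun l =>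
    sum_pos (fun i _ => sum_pos' (fun j _ => H_nonneg l i j)
      ⟨σ l i, mem_univ _, (H_pos l i _).2 rfl⟩) univ_nonempty
  have hPH : ∀ i j, P i j = ∑ l, w l * H l i j := by
    intro i j
    have h := congrFun₂ hdec i j
    simp only [Matrix.sum_apply, Matrix.smul_apply, Matrix.of_apply, smul_eq_mul,
      PEquiv.toMatrix_apply, Equiv.toPEquiv_apply, Option.mem_def, Option.some.injEq] at h
    have hne := (hr i).ne'
    have hne' := (hc j).ne'
    calc
      P i j = (r i * P i j * c j) * (r i * c j)⁻¹ := by field_simp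
      _ = _ := by
        rw [← h, sum_mul]
        refine sum_congr rfl fun l _ => ?_
        simp only [H, Matrix.of_apply, eq_comm (a := j)]
        split_ifs <;> simp
  refine ⟨L, ?_, ?_, fun l => w l * ∑ i, ∑ j, H l i j,
    fun l => (∑ i, ∑ j, H l i j)⁻¹ • H l, fun l => mul_pos (hw l) (mass_pos l), ?_,
    fun l i j => ?_, fun l => ?_, fun l => ⟨σ l, fun i j => ?_⟩, ?_⟩
  · rw [Nat.one_le_iff_ne_zero]
    rintro rfl
    simp at hw1
  · zify at hL
    push_cast
    linarith
  · rw [← hsum]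
    simp only [hPH, mul_sum]
    rw [sum_comm]
    exact sum_congr rfl fun i _ => sum_comm
  · exact mul_nonneg (inv_nonneg.2 (mass_pos l).le) (H_nonneg l i j)
  · simp only [Matrix.smul_apply, smul_eq_mul, ← mul_sum]
    exact inv_mul_cancel₀ (mass_pos l).ne'
  · exact (mul_pos_iff_of_pos_left (inv_pos.2 (mass_pos l))).trans (H_pos l i j)
  · ext i j
    rw [hPH, Matrix.sum_apply]
    refine sum_congr rfl fun l _ => ?_
    rw [smul_smul, mul_inv_cancel_right₀ (mass_pos l).ne', Matrix.smul_apply, smul_eq_mul]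
end
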